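/- Let N ≥ 1, λ > 0, let Ψ : {0,1}^N → ℝ be bounded, let p_i⁰ ∈ (0,1), and let G : (0,1)^N → ℝ be the mean-field Kullback–Leibler objective G(q) = Σ_{x ∈ {0,1}^N} Ψ(x) Π_j q_j^{x_j}(1−q_j)^{1−x_j} + Σ_i [ (1−q_i)log((1−q_i)/(1−p_i⁰)) + q_i·log(q_i/p_i⁰) ]. Let (Q^t) be the sequence generated by the proximal alternate minimization algorithm with Q⁰ = (p_1⁰,…,p_N⁰), converging to the critical point Q̄, and let θ ∈ [1/2,1) be the Kurdyka–Łojasiewicz exponent of G at Q̄ (with φ(s) = c·s^{1−θ}). Then: (i) if θ = 1/2 there exist C ≥ 0 and τ ∈ [0,1) with ‖Q^t − Q̄‖ ≤ C·τ^t for all t; (ii) if θ ∈ (1/2,1) there exists C ≥ 0 with ‖Q^t − Q̄‖ ≤ C·t^{−(1−θ)/(2θ−1)} for all t ≥ 1. Moreover, if the Hessian of G is positive definite at Q̄ (SSOC), then case (i) applies and the convergence rate is linear. -/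

import Mathlib

open Filter Topology

/-- The concavity estimate for `s ↦ s ^ (1 - θ)`, multiplied by `x ^ θ`. -/
lemma one_sub_mul_sub_le_rpow_mul {θ x y : ℝ} (hθ0 : 0 < θ) (hθ1 : θ < 1) (hy : 0 ≤ y)
    (hyx : y ≤ x) : (1 - θ) * (x - y) ≤ x ^ θ * (x ^ (1 - θ) - y ^ (1 - θ)) := by
  rcases (hy.trans hyx).eq_or_lt with hx | hx
  · obtain rfl : y = x := le_antisymm hyx (hx ▸ hy)
    simp
  have hB := rpow_one_add_le_one_add_mul_self (s := y / x - 1) (p := 1 - θ)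
    (by linarith [div_nonneg hy hx.le]) (by linarith) (by linarith)
  rw [add_sub_cancel, Real.div_rpow hy hx.le, div_le_iff₀ (Real.rpow_pos_of_pos hx _)] at hB
  have hxx : x ^ θ * x ^ (1 - θ) = x := by
    rw [← Real.rpow_add hx, add_sub_cancel, Real.rpow_one]
  calc (1 - θ) * (x - y)
      = x - (1 + (1 - θ) * (y / x - 1)) * x := by field_simp; ring
    _ = x ^ θ * (x ^ (1 - θ) - (1 + (1 - θ) * (y / x - 1)) * x ^ (1 - θ)) := by
        linear_combination ((1 + (1 - θ) * (y / x - 1)) - 1) * hxx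
    _ ≤ _ := by gcongr

/-- Finite length estimate for sequences with sufficient decrease and the
Kurdyka–Łojasiewicz inequality. -/
lemma exists_dist_le_mul_rpow {X : Type*} [MetricSpace X] {u : ℕ → X} {x : X} {e : ℕ → ℝ}
    {a b θ : ℝ} (ha : 0 < a) (hb : 0 < b) (hθ : θ ∈ Set.Ico (1 / 2 : ℝ) 1)
    (he0 : ∀ t, 0 ≤ e t) (he1 : ∀ t, e t ≤ 1) (hu : Tendsto u atTop (𝓝 x))
    (hdesc : ∀ t, e (t + 1) + a * dist (u t) (u (t + 1)) ^ 2 ≤ e t)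
    (hkl : ∀ t, e (t + 1) ^ θ ≤ b * dist (u t) (u (t + 1))) :
    ∃ C, 0 < C ∧ ∀ t, dist (u (t + 1)) x ≤ C * e t ^ (1 - θ) := by
  obtain ⟨hθ0, hθ1⟩ := hθ
  have hanti : ∀ t, e (t + 1) ≤ e t := fun t => by
    have := hdesc t
    nlinarith [sq_nonneg (dist (u t) (u (t + 1)))]
  set A := b / ((1 - θ) * a) with hA
  have h1θ : 0 < 1 - θ := by linarith
  have hApos : 0 < A := by positivity
  have hstep : ∀ t, 2 * dist (u (t + 1)) (u (t + 2)) ≤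
      dist (u t) (u (t + 1)) + A * (e (t + 1) ^ (1 - θ) - e (t + 2) ^ (1 - θ)) := by
    intro t
    have hΔ : 0 ≤ e (t + 1) ^ (1 - θ) - e (t + 2) ^ (1 - θ) :=
      sub_nonneg.2 (Real.rpow_le_rpow (he0 _) (hanti _) h1θ.le)
    have h1 := one_sub_mul_sub_le_rpow_mul (by linarith) hθ1 (he0 (t + 2)) (hanti (t + 1))
    have h2 := mul_le_mul_of_nonneg_right (hkl t) hΔ
    have h3 := hdesc (t + 1)
    generalize e (t + 1) ^ (1 - θ) - e (t + 2) ^ (1 - θ) = Δ at *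
    have h4 : dist (u (t + 1)) (u (t + 2)) ^ 2 ≤ dist (u t) (u (t + 1)) * (A * Δ) := by
      have : (1 - θ) * (a * dist (u (t + 1)) (u (t + 2)) ^ 2) ≤
          b * dist (u t) (u (t + 1)) * Δ :=
        (mul_le_mul_of_nonneg_left (by linarith) h1θ.le).trans (h1.trans h2)
      rw [hA, div_mul_eq_mul_div, mul_div_assoc', le_div_iff₀ (by positivity)]
      linarith
    refine le_of_sq_le_sq ?_ (by positivity)
    nlinarith [sq_nonneg (dist (u t) (u (t + 1)) - A * Δ)]
  have hlen : ∀ t n, dist (u (t + 1)) (u (t + 1 + n)) + dist (u (t + n)) (u (t + n + 1)) ≤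
      dist (u t) (u (t + 1)) + A * (e (t + 1) ^ (1 - θ) - e (t + 1 + n) ^ (1 - θ)) := by
    intro t n
    induction n with
    | zero => simp
    | succ n ih =>
      have h1 := hstep (t + n)
      have h2 := dist_triangle (u (t + 1)) (u (t + 1 + n)) (u (t + 1 + n + 1))
      simp only [show t + (n + 1) = t + n + 1 by ring, show t + 1 + (n + 1) = t + n + 2 by ring,
        show t + 1 + n = t + n + 1 by ring, show t + n + 1 + 1 = t + n + 2 by ring] at *
      linarith
  refine ⟨1 / √a + A, by positivity, fun t => ?_⟩
  have hlim : dist (u (t + 1)) x ≤ dist (u t) (u (t + 1)) + A * e (t + 1) ^ (1 - θ) := by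
    have ht : Tendsto (fun n => u (t + 1 + n)) atTop (𝓝 x) :=
      (hu.comp (tendsto_add_atTop_nat (t + 1))).congr fun n => by
        simp [add_comm, add_left_comm]
    refine le_of_tendsto (tendsto_const_nhds.dist ht) (Eventually.of_forall fun n => ?_)
    have := hlen t n
    have h0 := mul_nonneg hApos.le (Real.rpow_nonneg (he0 (t + 1 + n)) (1 - θ))
    linarith [dist_nonneg (x := u (t + n)) (y := u (t + n + 1))]
  have hd : dist (u t) (u (t + 1)) ≤ 1 / √a * e t ^ (1 - θ) := by
    have h1 : dist (u t) (u (t + 1)) ≤ √(e t / a) := by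
      apply Real.le_sqrt_of_sq_le
      rw [le_div_iff₀ ha]
      linarith [hdesc t, he0 (t + 1)]
    have h2 : √(e t) ≤ e t ^ (1 - θ) := by
      rw [Real.sqrt_eq_rpow]
      exact Real.rpow_le_rpow_of_exponent_ge_of_imp (he0 t) (he1 t) (by linarith)
        fun _ h => absurd h (by linarith)
    rw [Real.sqrt_div (he0 t)] at h1
    rw [one_div_mul_eq_div]
    exact h1.trans (by gcongr)
  have he : e (t + 1) ^ (1 - θ) ≤ e t ^ (1 - θ) :=
    Real.rpow_le_rpow (he0 _) (hanti _) h1θ.le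
  nlinarith [mul_le_mul_of_nonneg_left he hApos.le]

/-- Linear decay of the energy for the exponent `1 / 2`. -/
lemma le_geometric_of_le_mul_sub {e : ℕ → ℝ} {K : ℝ} (hK : 0 < K) (he1 : ∀ t, e t ≤ 1)
    (h : ∀ t, e (t + 1) ≤ K * (e t - e (t + 1))) (t : ℕ) : e t ≤ (K / (1 + K)) ^ t := by
  induction t with
  | zero => simpa using he1 0
  | succ t ih =>
    calc e (t + 1) ≤ K / (1 + K) * e t := by
          rw [div_mul_eq_mul_div, le_div_iff₀ (by positivity)]
          linarith [h t]
      _ ≤ K / (1 + K) * (K / (1 + K)) ^ t := by gcongr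
      _ = _ := (pow_succ' _ _).symm

lemma rpow_neg_add_le_rpow_neg {K p x y : ℝ} (hK : 0 < K) (hp0 : 0 < p) (hp1 : p ≤ 1)
    (hx : 0 < x) (hx1 : x ≤ 1) (h : x ^ (1 + p) ≤ K * (y - x)) :
    y ^ (-p) + p / (K + 1) ≤ x ^ (-p) := by
  have hxp : 0 < x ^ p := Real.rpow_pos_of_pos hx p
  have hxp1 : x ^ p ≤ 1 := Real.rpow_le_one hx.le hx1 hp0.le
  rw [Real.rpow_add hx, Real.rpow_one] at h
  have hy : x * (1 + x ^ p / K) ≤ y := by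
    have : x * x ^ p / K ≤ y - x := by rwa [div_le_iff₀' hK]
    calc x * (1 + x ^ p / K) = x + x * x ^ p / K := by ring
      _ ≤ y := by linarith
  have hy0 : 0 < y := lt_of_lt_of_le (by positivity) hy
  have hw : x / y ≤ 1 + -(x ^ p / (K + x ^ p)) := by
    rw [div_le_iff₀ hy0]
    calc x = (1 + -(x ^ p / (K + x ^ p))) * (x * (1 + x ^ p / K)) := by field_simp; ring
      _ ≤ _ := by
        gcongr
        rw [← sub_eq_add_neg, sub_nonneg, div_le_one (by positivity)]
        linarith
  have hB : (x / y) ^ p ≤ 1 - p * (x ^ p / (K + 1)) := by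
    calc (x / y) ^ p ≤ (1 + -(x ^ p / (K + x ^ p))) ^ p := by gcongr
      _ ≤ 1 + p * -(x ^ p / (K + x ^ p)) :=
        rpow_one_add_le_one_add_mul_self
          (by rw [neg_le_neg_iff, div_le_one (by positivity)]; linarith) hp0.le hp1
      _ ≤ 1 - p * (x ^ p / (K + 1)) := by
        have : x ^ p / (K + 1) ≤ x ^ p / (K + x ^ p) := by gcongr
        nlinarith
  rw [Real.div_rpow hx.le hy0.le] at hB
  rw [Real.rpow_neg hx.le, Real.rpow_neg hy0.le]
  calc (y ^ p)⁻¹ + p / (K + 1) = (x ^ p)⁻¹ * (x ^ p / y ^ p) + p / (K + 1) := by field_simp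
    _ ≤ (x ^ p)⁻¹ * (1 - p * (x ^ p / (K + 1))) + p / (K + 1) := by gcongr
    _ = _ := by field_simp; ring

/-- Sublinear decay of the energy for exponents above `1 / 2`. -/
lemma rpow_le_of_rpow_one_add_le {e : ℕ → ℝ} {K p s : ℝ} (hK : 0 < K) (hp0 : 0 < p) (hp1 : p ≤ 1)
    (hs : 0 < s) (he0 : ∀ t, 0 ≤ e t) (he1 : ∀ t, e t ≤ 1)
    (h : ∀ t, e (t + 1) ^ (1 + p) ≤ K * (e t - e (t + 1))) (t : ℕ) :
    e (t + 1) ^ s ≤ (p / (K + 1) * (t + 1)) ^ (-(s / p)) := by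
  have hμ : 0 < p / (K + 1) := by positivity
  have hanti : ∀ t, e (t + 1) ≤ e t := fun t => by
    have := (Real.rpow_nonneg (he0 (t + 1)) (1 + p)).trans (h t)
    linarith [nonneg_of_mul_nonneg_right this hK]
  rcases (he0 (t + 1)).eq_or_lt with h0 | hpos
  · rw [← h0, Real.zero_rpow hs.ne']
    positivity
  have key : ∀ n, 0 < e n → p / (K + 1) * n ≤ e n ^ (-p) := by
    intro n
    induction n with
    | zero => intro hn; simpa using Real.rpow_nonneg hn.le _
    | succ n ih =>
      intro hn
      have h1 := rpow_neg_add_le_rpow_neg hK hp0 hp1 hn (he1 _) (h n)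
      have h2 := ih (hn.trans_le (hanti n))
      push_cast
      linarith
  have hk := key _ hpos
  push_cast at hk
  have hsp : s = -p * -(s / p) := by field_simp
  calc e (t + 1) ^ s = (e (t + 1) ^ (-p)) ^ (-(s / p)) := by
        rw [← Real.rpow_mul hpos.le, ← hsp]
    _ ≤ _ := Real.rpow_le_rpow_of_nonpos (by positivity) hk (by
        rw [neg_nonpos]; positivity)

lemma rpow_two_mul_le_mul_sub {a b θ d x y : ℝ} (ha : 0 < a) (hy : 0 ≤ y)
    (hdesc : y + a * d ^ 2 ≤ x) (hkl : y ^ θ ≤ b * d) :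
    y ^ (2 * θ) ≤ b ^ 2 / a * (x - y) := by
  have h1 : (y ^ θ) ^ 2 ≤ (b * d) ^ 2 := pow_le_pow_left₀ (Real.rpow_nonneg hy _) hkl 2
  rw [mul_comm, Real.rpow_mul hy, Real.rpow_two]
  calc (y ^ θ) ^ 2 ≤ b ^ 2 / a * (a * d ^ 2) := by field_simp; linarith
    _ ≤ _ := by gcongr; linarith

lemma exists_le_mul_of_shift {f g : ℕ → ℝ} {C : ℝ} {T : ℕ} (hf : ∀ t, 0 ≤ f t) (hg : ∀ t, 0 ≤ g t)
    (h : ∀ t, f (t + T) ≤ C * g (t + T)) :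
    ∃ C' ≥ (0 : ℝ), ∀ t, g t ≠ 0 → f t ≤ C' * g t := by
  have hO : f =O[atTop] g := Asymptotics.IsBigO.of_bound C <| eventually_atTop.2 ⟨T, fun t ht => by
    obtain ⟨n, rfl⟩ := Nat.exists_eq_add_of_le' ht
    rw [Real.norm_of_nonneg (hf _), Real.norm_of_nonneg (hg _)]
    exact h n⟩
  obtain ⟨C', hC', hb⟩ := Asymptotics.bound_of_isBigO_nat_atTop hO
  refine ⟨C', hC'.le, fun t ht => ?_⟩
  simpa only [Real.norm_of_nonneg (hf _), Real.norm_of_nonneg (hg _)] using hb ht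

/-- Linear convergence for the Łojasiewicz exponent `1 / 2`. -/
lemma exists_dist_le_geometric {X : Type*} [MetricSpace X] {u : ℕ → X} {x : X} {e : ℕ → ℝ}
    {a b : ℝ} (ha : 0 < a) (hb : 0 < b) (hu : Tendsto u atTop (𝓝 x))
    (he0 : ∀ᶠ t in atTop, 0 ≤ e t) (he1 : ∀ᶠ t in atTop, e t ≤ 1)
    (hdesc : ∀ᶠ t in atTop, e (t + 1) + a * dist (u t) (u (t + 1)) ^ 2 ≤ e t)
    (hkl : ∀ᶠ t in atTop, e (t + 1) ^ (1 / 2 : ℝ) ≤ b * dist (u t) (u (t + 1))) :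
    ∃ C ≥ (0 : ℝ), ∃ τ ∈ Set.Ico (0 : ℝ) 1, ∀ t, dist (u t) x ≤ C * τ ^ t := by
  obtain ⟨T, hT⟩ := eventually_atTop.1 (he0.and (he1.and (hdesc.and hkl)))
  have hS : ∀ t, T ≤ t + T := fun t => Nat.le_add_left _ _
  have hsh : ∀ t, t + 1 + T = t + T + 1 := fun t => by ring
  obtain ⟨C, hC, hd⟩ := exists_dist_le_mul_rpow (u := fun t => u (t + T)) (e := fun t => e (t + T))
    (θ := 1 / 2) ha hb (by norm_num) (fun t => (hT _ (hS t)).1) (fun t => (hT _ (hS t)).2.1)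
    (hu.comp (tendsto_add_atTop_nat T))
    (fun t => by rw [hsh]; exact (hT _ (hS t)).2.2.1)
    (fun t => by rw [hsh]; exact (hT _ (hS t)).2.2.2)
  have hK : 0 < b ^ 2 / a := by positivity
  set K := b ^ 2 / a
  have hgeo := le_geometric_of_le_mul_sub (e := fun t => e (t + T)) hK
    (fun t => (hT _ (hS t)).2.1) (fun t => by
      have := rpow_two_mul_le_mul_sub ha (hT _ ((hS t).trans (Nat.le_succ _))).1
        (hT _ (hS t)).2.2.1 (hT _ (hS t)).2.2.2
      rw [mul_one_div_cancel two_ne_zero, Real.rpow_one] at this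
      rw [hsh]; exact this)
  have hρ0 : 0 < K / (1 + K) := by positivity
  have hρ1 : K / (1 + K) < 1 := by rw [div_lt_one (by positivity)]; linarith
  set ρ := K / (1 + K)
  have hτ : 0 < √ρ := Real.sqrt_pos.2 hρ0
  obtain ⟨C', hC', hfin⟩ := exists_le_mul_of_shift (f := fun t => dist (u t) x)
    (g := fun t => √ρ ^ t) (C := C / √ρ ^ (T + 1)) (T := T + 1) (fun _ => dist_nonneg)
    (fun _ => by positivity) (fun t => by
      have h1 : e (t + T) ^ (1 - 1 / 2 : ℝ) ≤ √ρ ^ t := by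
        rw [show (1 - 1 / 2 : ℝ) = 1 / 2 by norm_num, ← Real.sqrt_eq_rpow]
        refine Real.sqrt_le_iff.2 ⟨by positivity, ?_⟩
        rw [pow_right_comm, Real.sq_sqrt hρ0.le]
        exact hgeo t
      calc dist (u (t + (T + 1))) x ≤ C * e (t + T) ^ (1 - 1 / 2 : ℝ) := by
            have := hd t
            rwa [hsh] at this
        _ ≤ C * √ρ ^ t := by gcongr
        _ = _ := by rw [pow_add]; field_simp; ring)
  exact ⟨C', hC', √ρ, ⟨hτ.le, by rw [Real.sqrt_lt' one_pos]; simpa using hρ1⟩, fun t => hfin t (by positivity)⟩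

/-- Sublinear convergence for Łojasiewicz exponents in `(1 / 2, 1)`. -/
lemma exists_dist_le_rpow {X : Type*} [MetricSpace X] {u : ℕ → X} {x : X} {e : ℕ → ℝ}
    {a b θ : ℝ} (ha : 0 < a) (hb : 0 < b) (hθ : θ ∈ Set.Ioo (1 / 2 : ℝ) 1)
    (hu : Tendsto u atTop (𝓝 x))
    (he0 : ∀ᶠ t in atTop, 0 ≤ e t) (he1 : ∀ᶠ t in atTop, e t ≤ 1)
    (hdesc : ∀ᶠ t in atTop, e (t + 1) + a * dist (u t) (u (t + 1)) ^ 2 ≤ e t)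
    (hkl : ∀ᶠ t in atTop, e (t + 1) ^ θ ≤ b * dist (u t) (u (t + 1))) :
    ∃ C ≥ (0 : ℝ), ∀ t : ℕ, 1 ≤ t →
      dist (u t) x ≤ C * (t : ℝ) ^ (-(1 - θ) / (2 * θ - 1)) := by
  obtain ⟨hθ0, hθ1⟩ := hθ
  obtain ⟨T, hT⟩ := eventually_atTop.1 (he0.and (he1.and (hdesc.and hkl)))
  have hS : ∀ t, T ≤ t + T := fun t => Nat.le_add_left _ _
  have hsh : ∀ t, t + 1 + T = t + T + 1 := fun t => by ring
  obtain ⟨C, hC, hd⟩ := exists_dist_le_mul_rpow (u := fun t => u (t + T)) (e := fun t => e (t + T))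
    (θ := θ) ha hb ⟨hθ0.le, hθ1⟩ (fun t => (hT _ (hS t)).1) (fun t => (hT _ (hS t)).2.1)
    (hu.comp (tendsto_add_atTop_nat T))
    (fun t => by rw [hsh]; exact (hT _ (hS t)).2.2.1)
    (fun t => by rw [hsh]; exact (hT _ (hS t)).2.2.2)
  have hK : 0 < b ^ 2 / a := by positivity
  have hp : 0 < 2 * θ - 1 := by linarith
  have hrate := rpow_le_of_rpow_one_add_le (e := fun t => e (t + T)) hK hp (by linarith)
    (sub_pos.2 hθ1) (fun t => (hT _ (hS t)).1) (fun t => (hT _ (hS t)).2.1) (fun t => by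
      have := rpow_two_mul_le_mul_sub ha (hT _ ((hS t).trans (Nat.le_succ _))).1
        (hT _ (hS t)).2.2.1 (hT _ (hS t)).2.2.2
      rw [hsh, add_sub_cancel]; exact this)
  have hμ : 0 < (2 * θ - 1) / (b ^ 2 / a + 1) := by positivity
  set μ := (2 * θ - 1) / (b ^ 2 / a + 1)
  set r := (1 - θ) / (2 * θ - 1)
  have hr0 : 0 < r := div_pos (sub_pos.2 hθ1) hp
  obtain ⟨C', hC', hfin⟩ := exists_le_mul_of_shift (f := fun t => dist (u t) x)
    (g := fun t : ℕ => (t : ℝ) ^ (-r)) (C := C * (μ / (T + 3)) ^ (-r)) (T := T + 2)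
    (fun _ => dist_nonneg) (fun _ => by positivity) (fun t => by
      have h1 : μ / (T + 3) * ((t + (T + 2) : ℕ) : ℝ) ≤ μ * (t + 1) := by
        rw [div_mul_eq_mul_div, div_le_iff₀ (by positivity), mul_assoc]
        gcongr
        push_cast
        nlinarith [Nat.cast_nonneg (α := ℝ) t, Nat.cast_nonneg (α := ℝ) T,
          mul_nonneg (Nat.cast_nonneg (α := ℝ) t) (Nat.cast_nonneg (α := ℝ) T)]
      calc dist (u (t + (T + 2))) x ≤ C * e (t + 1 + T) ^ (1 - θ) := by
            have := hd (t + 1)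
            rwa [show t + 1 + 1 + T = t + (T + 2) by ring] at this
        _ ≤ C * (μ * (t + 1)) ^ (-r) := by gcongr; exact hrate t
        _ ≤ C * (μ / (T + 3) * ((t + (T + 2) : ℕ) : ℝ)) ^ (-r) := by
            gcongr ?_ * ?_
            exact Real.rpow_le_rpow_of_nonpos (by positivity) h1 (by linarith)
        _ = _ := by rw [Real.mul_rpow (by positivity) (by positivity), mul_assoc])
  refine ⟨C', hC', fun t ht => ?_⟩
  rw [neg_div]
  have : (0 : ℝ) < t := by exact_mod_cast ht
  exact hfin t (by positivity)

/-- A nondegenerate minimizer has Łojasiewicz exponent `1 / 2`. -/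
lemma exists_sqrt_le_norm_fderiv {E : Type*} [NormedAddCommGroup E] [NormedSpace ℝ E]
    [FiniteDimensional ℝ E] {f : E → ℝ} {x : E} (hf : ContDiffAt ℝ 2 f x)
    (hx : fderiv ℝ f x = 0) (hH : ∀ v, v ≠ 0 → 0 < fderiv ℝ (fderiv ℝ f) x v v) :
    ∃ κ > 0, ∀ᶠ q in 𝓝 x, (f q - f x) ^ (1 / 2 : ℝ) ≤ κ * ‖fderiv ℝ f q‖ := by
  set H := fderiv ℝ (fderiv ℝ f) x
  obtain ⟨m, hm, hcoer⟩ : ∃ m > 0, ∀ v, m * ‖v‖ ^ 2 ≤ H v v := by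
    rcases (Metric.sphere (0 : E) 1).eq_empty_or_nonempty with hS | hS
    · refine ⟨1, one_pos, fun v => ?_⟩
      by_cases hv : v = 0
      · simp [hv]
      · have : ‖v‖⁻¹ • v ∈ Metric.sphere (0 : E) 1 := by
          simp [norm_smul, inv_mul_cancel₀ (norm_ne_zero_iff.2 hv)]
        simp [hS] at this
    · have hcont : ContinuousOn (fun v => H v v) (Metric.sphere (0 : E) 1) := by fun_prop
      obtain ⟨w, hw, hmin⟩ := (isCompact_sphere (0 : E) 1).exists_isMinOn hS hcont
      have hw0 : w ≠ 0 := by rintro rfl; simp at hw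
      refine ⟨H w w, hH w hw0, fun v => ?_⟩
      by_cases hv : v = 0
      · simp [hv]
      · have hv' : ‖v‖ ≠ 0 := norm_ne_zero_iff.2 hv
        have hmem : ‖v‖⁻¹ • v ∈ Metric.sphere (0 : E) 1 := by
          simp [norm_smul, inv_mul_cancel₀ hv']
        have h : H w w ≤ H (‖v‖⁻¹ • v) (‖v‖⁻¹ • v) := hmin hmem
        simp only [map_smul, smul_eq_mul, smul_apply] at h
        calc H w w * ‖v‖ ^ 2 ≤ (‖v‖⁻¹ * (‖v‖⁻¹ * H v v)) * ‖v‖ ^ 2 := by gcongr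
          _ = H v v := by field_simp
  have hf' : ContDiffAt ℝ 1 (fderiv ℝ f) x := hf.fderiv_right (by norm_num)
  have hlo := (hf'.differentiableAt one_ne_zero).hasFDerivAt.isLittleO.def (half_pos hm)
  obtain ⟨K, s, hs, hK⟩ := hf'.exists_lipschitzOnWith
  have hd : ∀ᶠ q in 𝓝 x, DifferentiableAt ℝ f q :=
    (hf.eventually (by simp)).mono fun q hq => hq.differentiableAt two_ne_zero
  obtain ⟨r, hr, hball⟩ := Metric.eventually_nhds_iff_ball.1 ((eventually_mem_set.2 hs).and hd)
  refine ⟨√K * (2 / m) + 1, by positivity, ?_⟩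
  filter_upwards [hlo, Metric.ball_mem_nhds x hr] with q hq hqr
  rw [hx, sub_zero] at hq
  have hnorm : ‖q - x‖ ≤ 2 / m * ‖fderiv ℝ f q‖ := by
    rcases (norm_nonneg (q - x)).eq_or_lt with h0 | hpos
    · rw [← h0]; positivity
    have h1 := hcoer (q - x)
    have h2 := (le_abs_self _).trans ((fderiv ℝ f q).le_opNorm (q - x))
    have h3 := ((neg_le_abs _).trans ((fderiv ℝ f q - H (q - x)).le_opNorm (q - x))).trans
      (mul_le_mul_of_nonneg_right hq (norm_nonneg _))
    rw [sub_apply] at h3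
    have h4 : m / 2 * ‖q - x‖ * ‖q - x‖ ≤ ‖fderiv ℝ f q‖ * ‖q - x‖ := by nlinarith
    have h5 := le_of_mul_le_mul_right h4 hpos
    rw [div_mul_eq_mul_div, le_div_iff₀ hm]
    linarith
  have hxs : x ∈ s := mem_of_mem_nhds hs
  have hsub : Metric.closedBall x ‖q - x‖ ⊆ Metric.ball x r :=
    Metric.closedBall_subset_ball (by rwa [← dist_eq_norm])
  have hquad : f q - f x ≤ K * ‖q - x‖ * ‖q - x‖ := by
    refine (le_abs_self _).trans (Convex.norm_image_sub_le_of_norm_fderiv_le (𝕜 := ℝ)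
      (s := Metric.closedBall x ‖q - x‖) (fun y hy => (hball y (hsub hy)).2) (fun y hy => ?_)
      (convex_closedBall _ _) (Metric.mem_closedBall_self (norm_nonneg _)) ?_)
    · have h := hK.dist_le_mul y (hball y (hsub hy)).1 x hxs
      rw [dist_eq_norm, hx, sub_zero] at h
      exact h.trans (by gcongr; exact hy)
    · rw [Metric.mem_closedBall, dist_eq_norm]
  calc (f q - f x) ^ (1 / 2 : ℝ) = √(f q - f x) := (Real.sqrt_eq_rpow _).symm
    _ ≤ √(K * ‖q - x‖ * ‖q - x‖) := Real.sqrt_le_sqrt hquad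
    _ = √K * ‖q - x‖ := by
      rw [mul_assoc, Real.sqrt_mul K.coe_nonneg, Real.sqrt_mul_self (norm_nonneg _)]
    _ ≤ √K * (2 / m * ‖fderiv ℝ f q‖) := by gcongr
    _ ≤ _ := by rw [← mul_assoc]; gcongr; linarith

lemma sub_add_sq_div_le_mul_log {q p : ℝ} (hq : q ∈ Set.Ioo (0 : ℝ) 1)
    (hp : p ∈ Set.Ioo (0 : ℝ) 1) : q - p + (q - p) ^ 2 / 4 ≤ q * Real.log (q / p) := by
  obtain ⟨hq0, hq1⟩ := hq
  obtain ⟨hp0, hp1⟩ := hp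
  have hsq : 0 < √q := Real.sqrt_pos.2 hq0
  have hsp : 0 < √p := Real.sqrt_pos.2 hp0
  have hq2 := Real.sq_sqrt hq0.le
  have hp2 := Real.sq_sqrt hp0.le
  have hsq1 : √q ≤ 1 := Real.sqrt_le_one.2 hq1.le
  have hsp1 : √p ≤ 1 := Real.sqrt_le_one.2 hp1.le
  generalize √q = a at *
  generalize √p = b at *
  subst hq2 hp2
  have hlog : Real.log (a ^ 2 / b ^ 2) = -(2 * Real.log (b / a)) := by
    rw [← div_pow, Real.log_pow, ← inv_div, Real.log_inv]; simp
  have h1 := Real.log_le_sub_one_of_pos (div_pos hsp hsq)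
  rw [hlog]
  have h2 : a ^ 2 * Real.log (b / a) ≤ a * b - a ^ 2 := by
    calc a ^ 2 * Real.log (b / a) ≤ a ^ 2 * (b / a - 1) := by gcongr
      _ = _ := by field_simp
  have h3 : (a + b) ^ 2 ≤ 4 := by nlinarith
  nlinarith [mul_le_mul_of_nonneg_left h3 (sq_nonneg (a - b))]

/-- Strong convexity of the Bernoulli relative entropy. -/
lemma sq_div_two_le_bernoulli_kl {q p : ℝ} (hq : q ∈ Set.Ioo (0 : ℝ) 1)
    (hp : p ∈ Set.Ioo (0 : ℝ) 1) :
    (q - p) ^ 2 / 2 ≤ q * Real.log (q / p) + (1 - q) * Real.log ((1 - q) / (1 - p)) := by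
  have h1 := sub_add_sq_div_le_mul_log hq hp
  have h2 := sub_add_sq_div_le_mul_log (q := 1 - q) (p := 1 - p)
    ⟨by linarith [hq.2], by linarith [hq.1]⟩ ⟨by linarith [hp.2], by linarith [hp.1]⟩
  linarith

lemma hasDerivAt_bernoulli_kl {q p : ℝ} (hq : q ∈ Set.Ioo (0 : ℝ) 1)
    (hp : p ∈ Set.Ioo (0 : ℝ) 1) :
    HasDerivAt (fun q => q * Real.log (q / p) + (1 - q) * Real.log ((1 - q) / (1 - p)))
      ((Real.log q - Real.log (1 - q)) - (Real.log p - Real.log (1 - p))) q := by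
  have hq0 : q ≠ 0 := hq.1.ne'
  have hp0 : p ≠ 0 := hp.1.ne'
  have hq1 : 1 - q ≠ 0 := (sub_pos.2 hq.2).ne'
  have hp1 : 1 - p ≠ 0 := (sub_pos.2 hp.2).ne'
  have h1 := (hasDerivAt_id q).mul (((hasDerivAt_id q).div_const p).log (div_ne_zero hq0 hp0))
  have h2 := ((hasDerivAt_id q).const_sub 1).mul
    ((((hasDerivAt_id q).const_sub 1).div_const (1 - p)).log (div_ne_zero hq1 hp1))
  refine (h1.add h2).congr_deriv ?_
  simp only [id]
  rw [Real.log_div hq0 hp0, Real.log_div hq1 hp1]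
  field_simp
  ring

lemma hasDerivAt_comp_update {ι : Type*} [Fintype ι] [DecidableEq ι] {f : (ι → ℝ) → ℝ}
    {q : ι → ℝ} (hf : DifferentiableAt ℝ f q) (i : ι) :
    HasDerivAt (fun s => f (Function.update q i s)) (fderiv ℝ f q (Pi.single i 1)) (q i) := by
  have h : HasFDerivAt f (fderiv ℝ f q) (Function.update q i (q i)) := by
    rw [Function.update_eq_self]; exact hf.hasFDerivAt
  exact h.comp_hasDerivAt _ (hasDerivAt_update q i (q i))

lemma norm_le_sum_abs_apply_single {ι : Type*} [Fintype ι] [DecidableEq ι]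
    (L : (ι → ℝ) →L[ℝ] ℝ) : ‖L‖ ≤ ∑ i, |L (Pi.single i 1)| := by
  refine L.opNorm_le_bound (Finset.sum_nonneg fun _ _ => abs_nonneg _) fun v => ?_
  conv_lhs => rw [pi_eq_sum_univ' v]
  rw [map_sum, Finset.sum_mul]
  refine (norm_sum_le _ _).trans (Finset.sum_le_sum fun i _ => ?_)
  rw [map_smul, norm_smul, mul_comm, ← Real.norm_eq_abs]
  gcongr
  exact norm_le_pi_norm v i

lemma sqrt_sum_sq_le {ι : Type*} [Fintype ι] {v : ι → ℝ} {M : ℝ} (hM : ∀ i, |v i| ≤ M) :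
    √(∑ i, v i ^ 2) ≤ √(Fintype.card ι) * |M| := by
  rw [← Real.sqrt_sq_eq_abs, ← Real.sqrt_mul (Nat.cast_nonneg _)]
  gcongr
  calc ∑ i, v i ^ 2 ≤ ∑ _i : ι, M ^ 2 := Finset.sum_le_sum fun i _ => by
        rw [← sq_abs]; exact pow_le_pow_left₀ (abs_nonneg _) (hM i) 2
    _ = _ := by simp

lemma contDiffAt_mean_field {ι : Type*} [Fintype ι] [DecidableEq ι] {Ψ : (ι → Bool) → ℝ} {p0 q : ι → ℝ}
    (hp0 : ∀ i, p0 i ∈ Set.Ioo (0 : ℝ) 1) (hq : ∀ i, q i ∈ Set.Ioo (0 : ℝ) 1) :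
    ContDiffAt ℝ 2 (fun q : ι → ℝ =>
      (∑ x : ι → Bool, Ψ x * ∏ j, (if x j then q j else 1 - q j)) +
      ∑ i, ((1 - q i) * Real.log ((1 - q i) / (1 - p0 i)) + q i * Real.log (q i / p0 i))) q := by
  have hc : ∀ i, ContDiffAt ℝ 2 (fun q : ι → ℝ => q i) q := fun i => by fun_prop
  refine ContDiffAt.add (ContDiffAt.sum fun x _ => contDiffAt_const.mul
    (contDiffAt_prod fun j _ => ?_)) (ContDiffAt.sum fun i _ => ?_)
  · split_ifs
    · exact hc j
    · exact contDiffAt_const.sub (hc j)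
  · have h1 : 1 - q i ≠ 0 := (sub_pos.2 (hq i).2).ne'
    have h2 : 1 - p0 i ≠ 0 := (sub_pos.2 (hp0 i).2).ne'
    exact ((contDiffAt_const.sub (hc i)).mul
      (((contDiffAt_const.sub (hc i)).div_const _).log (div_ne_zero h1 h2))).add
      ((hc i).mul (((hc i).div_const _).log (div_ne_zero (hq i).1.ne' (hp0 i).1.ne')))

/-- The point at which the `i`-th coordinate of `b` is replaced by `s`, the coordinates below `i`
having already been replaced by those of `a`. -/
def partialSweep {N : ℕ} (a b : Fin N → ℝ) (i : Fin N) (s : ℝ) : Fin N → ℝ :=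
  fun j => if j < i then a j else if j = i then s else b j

lemma update_partialSweep {N : ℕ} (a b : Fin N → ℝ) (i : Fin N) (s s' : ℝ) :
    Function.update (partialSweep a b i s) i s' = partialSweep a b i s' := by
  ext j
  rcases eq_or_ne j i with rfl | h <;> simp [partialSweep, *]

lemma partialSweep_self {N : ℕ} (a b : Fin N → ℝ) (i : Fin N) (s : ℝ) :
    partialSweep a b i s i = s := by
  simp [partialSweep]

/-- Sufficient decrease over one sweep of coordinate updates. -/
lemma sweep_decrease {N : ℕ} {G : (Fin N → ℝ) → ℝ} {a b : Fin N → ℝ} {μ : ℝ} (hμ : 0 < μ)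
    (h : ∀ i, G (partialSweep a b i (a i)) + μ * (a i - b i) ^ 2 ≤ G (partialSweep a b i (b i))) :
    G a + μ * dist b a ^ 2 ≤ G b := by
  set w : ℕ → Fin N → ℝ := fun k j => if j.val < k then a j else b j with hw
  have hw1 : ∀ i : Fin N, w (i + 1) = partialSweep a b i (a i) := fun i => by
    ext j
    simp only [hw, partialSweep, Fin.lt_def, Fin.ext_iff]
    split_ifs <;> first | rfl | omega | (congr 1; ext; omega)
  have hw0 : ∀ i : Fin N, w i = partialSweep a b i (b i) := fun i => by
    ext j
    simp only [hw, partialSweep, Fin.lt_def, Fin.ext_iff]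
    split_ifs <;> first | rfl | omega | (congr 1; ext; omega)
  have hanti : Antitone fun k => G (w k) := antitone_nat_of_succ_le fun k => by
    by_cases hk : k < N
    · have := h ⟨k, hk⟩
      rw [← hw1, ← hw0] at this
      nlinarith [mul_nonneg hμ.le (sq_nonneg (a ⟨k, hk⟩ - b ⟨k, hk⟩))]
    · refine le_of_eq (congrArg G (funext fun j => ?_))
      simp only [hw]
      rw [if_pos (by omega), if_pos (by omega)]
  have hwN : w N = a := by ext j; simp [hw]
  have hwz : w 0 = b := by ext j; simp [hw]
  have hle : G a ≤ G b := by simpa only [hwN, hwz] using hanti (Nat.zero_le N)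
  have hcoord : ∀ i, G a + μ * (a i - b i) ^ 2 ≤ G b := fun i => by
    have h1 := hanti (Nat.zero_le (i : ℕ))
    have h2 := hanti (Nat.succ_le_of_lt i.isLt)
    have h3 := h i
    simp only [Nat.succ_eq_add_one, hwN, hwz, hw1, hw0] at h1 h2
    linarith
  have hd : dist b a ≤ √((G b - G a) / μ) :=
    (dist_pi_le_iff (Real.sqrt_nonneg _)).2 fun i => by
      rw [dist_comm, Real.dist_eq]
      refine Real.abs_le_sqrt ?_
      rw [le_div_iff₀ hμ]
      linarith [hcoord i]
  have := (Real.le_sqrt dist_nonneg (div_nonneg (sub_nonneg.2 hle) hμ.le)).1 hd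
  rw [le_div_iff₀ hμ] at this
  linarith

/-- Relative error bound for the gradient along proximal coordinate sweeps. -/
lemma exists_norm_fderiv_le_mul_dist {N : ℕ} {G : (Fin N → ℝ) → ℝ} {lam : ℝ}
    {Q : ℕ → Fin N → ℝ} {Qbar : Fin N → ℝ} (hG : ContDiffAt ℝ 2 G Qbar)
    (hQ : Tendsto Q atTop (𝓝 Qbar)) (hQbar : ∀ i, Qbar i ∈ Set.Ioo (0 : ℝ) 1)
    (hcrit : ∀ t i, DifferentiableAt ℝ G (partialSweep (Q (t + 1)) (Q t) i (Q (t + 1) i)) →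
      fderiv ℝ G (partialSweep (Q (t + 1)) (Q t) i (Q (t + 1) i)) (Pi.single i 1) +
        lam * ((Real.log (Q (t + 1) i) - Real.log (1 - Q (t + 1) i)) -
          (Real.log (Q t i) - Real.log (1 - Q t i))) = 0) :
    ∃ b, ∀ᶠ t in atTop, ‖fderiv ℝ G (Q (t + 1))‖ ≤ b * dist (Q t) (Q (t + 1)) := by
  obtain ⟨K, s, hs, hK⟩ := (hG.fderiv_right (m := 1) (by norm_num)).exists_lipschitzOnWith
  have hd : ∀ᶠ q in 𝓝 Qbar, DifferentiableAt ℝ G q :=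
    (hG.eventually (by simp)).mono fun q hq => hq.differentiableAt two_ne_zero
  have hlogit : ∀ i, ContDiffAt ℝ 1 (fun x : ℝ => Real.log x - Real.log (1 - x)) (Qbar i) :=
    fun i => (contDiffAt_id.log (hQbar i).1.ne').sub
      ((contDiffAt_const.sub contDiffAt_id).log (sub_pos.2 (hQbar i).2).ne')
  choose K' s' hs' hK' using fun i => (hlogit i).exists_lipschitzOnWith
  have hQ1 : Tendsto (fun t => Q (t + 1)) atTop (𝓝 Qbar) := hQ.comp (tendsto_add_atTop_nat 1)
  have hcoord : ∀ i, Tendsto (fun t => Q t i) atTop (𝓝 (Qbar i)) := tendsto_pi_nhds.1 hQ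
  have hcoord1 : ∀ i, Tendsto (fun t => Q (t + 1) i) atTop (𝓝 (Qbar i)) := tendsto_pi_nhds.1 hQ1
  have hz : ∀ i, Tendsto (fun t => partialSweep (Q (t + 1)) (Q t) i (Q (t + 1) i)) atTop
      (𝓝 Qbar) := fun i => tendsto_pi_nhds.2 fun j => by
    unfold partialSweep
    split_ifs with h1 h2
    · exact hcoord1 j
    · exact h2 ▸ hcoord1 i
    · exact hcoord j
  refine ⟨∑ i, (K + |lam| * K' i), ?_⟩
  filter_upwards [hQ1 hs, eventually_all.2 fun i => hz i hs, eventually_all.2 fun i => hz i hd,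
    eventually_all.2 fun i => hcoord i (hs' i), eventually_all.2 fun i => hcoord1 i (hs' i)]
    with t h1 h2 h3 h4 h5
  refine (norm_le_sum_abs_apply_single _).trans ?_
  rw [Finset.sum_mul]
  refine Finset.sum_le_sum fun i _ => ?_
  have hc := hcrit t i (h3 i)
  set z := partialSweep (Q (t + 1)) (Q t) i (Q (t + 1) i) with hzdef
  have hzd : dist (Q (t + 1)) z ≤ dist (Q t) (Q (t + 1)) :=
    (dist_pi_le_iff dist_nonneg).2 fun j => by
      rw [hzdef]
      unfold partialSweep
      split_ifs with h1 h2
      · simp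
      · simp [h2]
      · rw [dist_comm]; exact dist_le_pi_dist _ _ j
  have hA : |fderiv ℝ G (Q (t + 1)) (Pi.single i 1) - fderiv ℝ G z (Pi.single i 1)| ≤
      K * dist (Q t) (Q (t + 1)) := by
    rw [← sub_apply, ← Real.norm_eq_abs]
    refine (ContinuousLinearMap.le_opNorm _ _).trans ?_
    rw [Pi.norm_single, norm_one, mul_one, ← dist_eq_norm]
    exact (hK.dist_le_mul _ h1 _ (h2 i)).trans (by gcongr)
  have hB : |(Real.log (Q (t + 1) i) - Real.log (1 - Q (t + 1) i)) -
      (Real.log (Q t i) - Real.log (1 - Q t i))| ≤ K' i * dist (Q t) (Q (t + 1)) := by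
    refine ((hK' i).dist_le_mul _ (h5 i) _ (h4 i)).trans ?_
    rw [dist_comm (Q t)]
    gcongr
    exact dist_le_pi_dist _ _ i
  generalize (Real.log (Q (t + 1) i) - Real.log (1 - Q (t + 1) i)) -
      (Real.log (Q t i) - Real.log (1 - Q t i)) = δ at hB hc
  calc |fderiv ℝ G (Q (t + 1)) (Pi.single i 1)|
      = |(fderiv ℝ G (Q (t + 1)) (Pi.single i 1) - fderiv ℝ G z (Pi.single i 1)) +
          -(lam * δ)| := by congr 1; linarith
    _ ≤ K * dist (Q t) (Q (t + 1)) + |lam| * (K' i * dist (Q t) (Q (t + 1))) := by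
        refine (abs_add_le _ _).trans (add_le_add hA ?_)
        rw [abs_neg, abs_mul]
        gcongr
    _ = _ := by ring

/-- The Kurdyka–Łojasiewicz inequality stated with the norm of the Fréchet derivative. -/
lemma exists_rpow_le_norm_fderiv {ι : Type*} [Fintype ι] [DecidableEq ι] {G : (ι → ℝ) → ℝ}
    {q₀ : ι → ℝ} {c θ : ℝ} (hG : ContDiffAt ℝ 2 G q₀) (hc : 0 < c) (hθ0 : 0 < θ) (hθ1 : θ < 1)
    (hKL : ∃ η > (0 : ℝ), ∃ U ∈ 𝓝 q₀, ∀ q ∈ U, G q₀ < G q → G q < G q₀ + η →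
      1 ≤ c * (1 - θ) * (G q - G q₀) ^ (-θ) *
        √(∑ i, (deriv (fun s => G (Function.update q i s)) (q i)) ^ 2)) :
    ∃ κ > 0, ∀ᶠ q in 𝓝 q₀, G q₀ ≤ G q → (G q - G q₀) ^ θ ≤ κ * ‖fderiv ℝ G q‖ := by
  obtain ⟨η, hη, U, hU, h⟩ := hKL
  have h1θ : 0 < 1 - θ := sub_pos.2 hθ1
  refine ⟨c * (1 - θ) * √(Fintype.card ι) + 1, by positivity, ?_⟩
  have hd : ∀ᶠ q in 𝓝 q₀, DifferentiableAt ℝ G q :=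
    (hG.eventually (by simp)).mono fun q hq => hq.differentiableAt two_ne_zero
  filter_upwards [hU, hd, hG.continuousAt.eventually_lt_const (by linarith : G q₀ < G q₀ + η)]
    with q hqU hqd hqη hle
  rcases hle.eq_or_lt with heq | hlt
  · rw [← heq, sub_self, Real.zero_rpow hθ0.ne']
    positivity
  have hgrad : √(∑ i, (deriv (fun s => G (Function.update q i s)) (q i)) ^ 2) ≤
      √(Fintype.card ι) * ‖fderiv ℝ G q‖ := by
    have := sqrt_sum_sq_le (v := fun i => deriv (fun s => G (Function.update q i s)) (q i))
      (M := ‖fderiv ℝ G q‖) fun i => by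
        rw [(hasDerivAt_comp_update hqd i).deriv]
        simpa [Pi.norm_single] using (fderiv ℝ G q).le_opNorm (Pi.single i 1)
    rwa [abs_norm] at this
  have hpos : 0 < (G q - G q₀) ^ θ := Real.rpow_pos_of_pos (sub_pos.2 hlt) θ
  have hq := h q hqU hlt hqη
  rw [Real.rpow_neg (sub_pos.2 hlt).le] at hq
  calc (G q - G q₀) ^ θ
      ≤ (G q - G q₀) ^ θ * (c * (1 - θ) * ((G q - G q₀) ^ θ)⁻¹ *
        √(∑ i, (deriv (fun s => G (Function.update q i s)) (q i)) ^ 2)) :=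
        le_mul_of_one_le_right hpos.le hq
    _ = c * (1 - θ) * √(∑ i, (deriv (fun s => G (Function.update q i s)) (q i)) ^ 2) := by
        field_simp
    _ ≤ c * (1 - θ) * (√(Fintype.card ι) * ‖fderiv ℝ G q‖) := by gcongr
    _ ≤ _ := by nlinarith [norm_nonneg (fderiv ℝ G q)]


/-- Convergence rates for the proximal alternate minimization
applied to the mean-field KL objective `G`. If the iterates `(Q^t)` (started
at the prior, each coordinate being the unique minimizer of the proximally
regularized coordinate objective) converge to the critical point `Q̄`, and `G`
has the Kurdyka–Łojasiewicz property at `Q̄` with `φ(s) = c·s^{1−θ}`,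
`θ ∈ [1/2,1)`, then: (i) if `θ = 1/2` the convergence is linear
(`‖Q^t − Q̄‖ ≤ C·τ^t`, `τ ∈ [0,1)`); (ii) if `θ ∈ (1/2,1)` then
`‖Q^t − Q̄‖ ≤ C·t^{−(1−θ)/(2θ−1)}` for `t ≥ 1`; and moreover under the SSOC
assumption (positive definite Hessian of `G` at `Q̄`) the linear rate of case
(i) holds. Euclidean norms are written out as square roots of sums of
squares, and `∇G` through the coordinatewise derivatives of `G`. -/
theorem proximal_alternate_minimization_rates
    (N : ℕ) (hN : 1 ≤ N) (lam : ℝ) (hlam : 0 < lam)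
    (Ψ : (Fin N → Bool) → ℝ) (hΨbdd : ∃ M : ℝ, ∀ x, |Ψ x| ≤ M)
    (p0 : Fin N → ℝ) (hp0 : ∀ i, p0 i ∈ Set.Ioo (0 : ℝ) 1)
    (G : (Fin N → ℝ) → ℝ)
    (hG : ∀ q : Fin N → ℝ, G q =
      (∑ x : Fin N → Bool, Ψ x * ∏ j, (if x j then q j else 1 - q j)) +
      ∑ i, ((1 - q i) * Real.log ((1 - q i) / (1 - p0 i)) +
        q i * Real.log (q i / p0 i)))
    (l : ℝ → ℝ → ℝ)
    (hl : ∀ q q0 : ℝ, l q q0 =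
      q * Real.log (q / q0) + (1 - q) * Real.log ((1 - q) / (1 - q0)))
    (Q : ℕ → Fin N → ℝ)
    (hQ0 : Q 0 = p0)
    (hQmem : ∀ t i, Q t i ∈ Set.Ioo (0 : ℝ) 1)
    (hstep : ∀ t : ℕ, ∀ i : Fin N, ∀ q ∈ Set.Ioo (0 : ℝ) 1, q ≠ Q (t + 1) i →
      G (fun j => if j < i then Q (t + 1) j else if j = i then Q (t + 1) i else Q t j) +
          lam * l (Q (t + 1) i) (Q t i)
        < G (fun j => if j < i then Q (t + 1) j else if j = i then q else Q t j) +
          lam * l q (Q t i))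
    (Qbar : Fin N → ℝ) (hQbarmem : ∀ i, Qbar i ∈ Set.Ioo (0 : ℝ) 1)
    (hconv : Filter.Tendsto Q Filter.atTop (nhds Qbar))
    (hcrit : ∀ i, deriv (fun s => G (Function.update Qbar i s)) (Qbar i) = 0)
    (c θ : ℝ) (hc : 0 < c) (hθ : θ ∈ Set.Ico (1 / 2 : ℝ) 1)
    (hKL : ∃ η > (0 : ℝ), ∃ U ∈ nhds Qbar, ∀ q ∈ U,
      G Qbar < G q → G q < G Qbar + η →
        1 ≤ c * (1 - θ) * (G q - G Qbar) ^ (-θ) *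
          Real.sqrt (∑ i, (deriv (fun s => G (Function.update q i s)) (q i)) ^ 2)) :
    (θ = 1 / 2 → ∃ C ≥ (0 : ℝ), ∃ τ ∈ Set.Ico (0 : ℝ) 1, ∀ t : ℕ,
      Real.sqrt (∑ i, (Q t i - Qbar i) ^ 2) ≤ C * τ ^ t) ∧
    (θ ∈ Set.Ioo (1 / 2 : ℝ) 1 → ∃ C ≥ (0 : ℝ), ∀ t : ℕ, 1 ≤ t →
      Real.sqrt (∑ i, (Q t i - Qbar i) ^ 2) ≤
        C * (t : ℝ) ^ (-(1 - θ) / (2 * θ - 1))) ∧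
    ((∀ v : Fin N → ℝ, v ≠ 0 → 0 < iteratedFDeriv ℝ 2 G Qbar ![v, v]) →
      ∃ C ≥ (0 : ℝ), ∃ τ ∈ Set.Ico (0 : ℝ) 1, ∀ t : ℕ,
        Real.sqrt (∑ i, (Q t i - Qbar i) ^ 2) ≤ C * τ ^ t) := by
  have hGeq := funext hG
  have hsm : ∀ q : Fin N → ℝ, (∀ i, q i ∈ Set.Ioo (0 : ℝ) 1) → ContDiffAt ℝ 2 G q := by
    intro q hq
    rw [hGeq]
    exact contDiffAt_mean_field hp0 hq
  have hsmbar := hsm Qbar hQbarmem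
  have hmin : ∀ t i, ∀ q ∈ Set.Ioo (0 : ℝ) 1,
      G (partialSweep (Q (t + 1)) (Q t) i (Q (t + 1) i)) + lam * l (Q (t + 1) i) (Q t i) ≤
        G (partialSweep (Q (t + 1)) (Q t) i q) + lam * l q (Q t i) := by
    intro t i q hq
    rcases eq_or_ne q (Q (t + 1) i) with rfl | hne
    · exact le_rfl
    · exact (hstep t i q hq hne).le
  have hdesc : ∀ t, G (Q (t + 1)) + lam / 2 * dist (Q t) (Q (t + 1)) ^ 2 ≤ G (Q t) := by
    refine fun t => sweep_decrease (half_pos hlam) fun i => ?_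
    have h1 := hmin t i (Q t i) (hQmem t i)
    have h2 := mul_le_mul_of_nonneg_left
      (sq_div_two_le_bernoulli_kl (hQmem (t + 1) i) (hQmem t i)) hlam.le
    rw [← hl] at h2
    have h3 : l (Q t i) (Q t i) = 0 := by
      rw [hl, div_self (hQmem t i).1.ne', div_self (sub_pos.2 (hQmem t i).2).ne', Real.log_one]
      ring
    rw [h3] at h1
    linarith
  have hopt : ∀ t i, DifferentiableAt ℝ G (partialSweep (Q (t + 1)) (Q t) i (Q (t + 1) i)) →
      fderiv ℝ G (partialSweep (Q (t + 1)) (Q t) i (Q (t + 1) i)) (Pi.single i 1) +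
        lam * ((Real.log (Q (t + 1) i) - Real.log (1 - Q (t + 1) i)) -
          (Real.log (Q t i) - Real.log (1 - Q t i))) = 0 := by
    intro t i hd
    have h1 := hasDerivAt_comp_update hd i
    simp only [update_partialSweep, partialSweep_self] at h1
    have h2 := (hasDerivAt_bernoulli_kl (hQmem (t + 1) i) (hQmem t i)).const_mul lam
    refine IsLocalMin.hasDerivAt_eq_zero ?_ (h1.add h2)
    filter_upwards [isOpen_Ioo.mem_nhds (hQmem (t + 1) i)] with q hq
    simpa only [Pi.add_apply, hl] using hmin t i q hq
  obtain ⟨b, hb⟩ := exists_norm_fderiv_le_mul_dist hsmbar hconv hQbarmem hopt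
  have hanti : Antitone fun t => G (Q t) := antitone_nat_of_succ_le fun t =>
    le_of_add_le_of_nonneg_left (hdesc t) (by positivity)
  have hGlim : Tendsto (fun t => G (Q t)) atTop (𝓝 (G Qbar)) :=
    hsmbar.continuousAt.tendsto.comp hconv
  have hGle : ∀ t, G Qbar ≤ G (Q t) := fun t => hanti.le_of_tendsto hGlim t
  have he0 : ∀ᶠ t in atTop, 0 ≤ G (Q t) - G Qbar :=
    Eventually.of_forall fun t => sub_nonneg.2 (hGle t)
  have he1 : ∀ᶠ t in atTop, G (Q t) - G Qbar ≤ 1 :=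
    (hGlim.eventually_lt_const (lt_add_one _)).mono fun t ht => by linarith
  have hdesc' : ∀ᶠ t in atTop, G (Q (t + 1)) - G Qbar +
      lam / 2 * dist (Q t) (Q (t + 1)) ^ 2 ≤ G (Q t) - G Qbar :=
    Eventually.of_forall fun t => by linarith [hdesc t]
  have hkl : ∀ ϑ κ : ℝ, 0 < κ →
      (∀ᶠ q in 𝓝 Qbar, G Qbar ≤ G q → (G q - G Qbar) ^ ϑ ≤ κ * ‖fderiv ℝ G q‖) →
      ∀ᶠ t in atTop, (G (Q (t + 1)) - G Qbar) ^ ϑ ≤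
        κ * (|b| + 1) * dist (Q t) (Q (t + 1)) := by
    intro ϑ κ hκ h
    filter_upwards [hb, (hconv.comp (tendsto_add_atTop_nat 1)).eventually h] with t h1 h2
    refine (h2 (hGle _)).trans ?_
    rw [mul_assoc]
    refine mul_le_mul_of_nonneg_left (h1.trans ?_) hκ.le
    gcongr
    linarith [le_abs_self b]
  have heucl : ∀ t, √(∑ i, (Q t i - Qbar i) ^ 2) ≤ √(Fintype.card (Fin N)) * dist (Q t) Qbar := by
    intro t
    have := sqrt_sum_sq_le (v := fun i => Q t i - Qbar i) (M := dist (Q t) Qbar) fun i =>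
      dist_le_pi_dist (Q t) Qbar i
    rwa [abs_of_nonneg dist_nonneg] at this
  have hlin : ∀ κ : ℝ, 0 < κ → (∀ᶠ q in 𝓝 Qbar, G Qbar ≤ G q →
      (G q - G Qbar) ^ (1 / 2 : ℝ) ≤ κ * ‖fderiv ℝ G q‖) →
      ∃ C ≥ (0 : ℝ), ∃ τ ∈ Set.Ico (0 : ℝ) 1, ∀ t : ℕ,
        √(∑ i, (Q t i - Qbar i) ^ 2) ≤ C * τ ^ t := by
    intro κ hκ h
    obtain ⟨C, hC, τ, hτ, hd⟩ := exists_dist_le_geometric (half_pos hlam)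
      (by positivity : 0 < κ * (|b| + 1)) hconv he0 he1 hdesc' (hkl _ κ hκ h)
    refine ⟨√(Fintype.card (Fin N)) * C, by positivity, τ, hτ, fun t => (heucl t).trans ?_⟩
    rw [mul_assoc]
    exact mul_le_mul_of_nonneg_left (hd t) (Real.sqrt_nonneg _)
  obtain ⟨κ, hκ, hKL'⟩ :=
    exists_rpow_le_norm_fderiv hsmbar hc (by linarith [hθ.1]) hθ.2 hKL
  refine ⟨?_, fun hθ' => ?_, fun hH => ?_⟩
  · rintro rfl
    exact hlin κ hκ hKL'
  · obtain ⟨C, hC, hd⟩ := exists_dist_le_rpow (half_pos hlam)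
      (by positivity : 0 < κ * (|b| + 1)) hθ' hconv he0 he1 hdesc' (hkl _ κ hκ hKL')
    refine ⟨√(Fintype.card (Fin N)) * C, by positivity, fun t ht => (heucl t).trans ?_⟩
    rw [mul_assoc]
    exact mul_le_mul_of_nonneg_left (hd t ht) (Real.sqrt_nonneg _)
  · have hzero : fderiv ℝ G Qbar = 0 := norm_le_zero_iff.1 <|
      (norm_le_sum_abs_apply_single _).trans_eq <| Finset.sum_eq_zero fun i _ => by
        rw [← (hasDerivAt_comp_update (hsmbar.differentiableAt two_ne_zero) i).deriv, hcrit i,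
          abs_zero]
    obtain ⟨κ', hκ', h⟩ := exists_sqrt_le_norm_fderiv hsmbar hzero fun v hv => by
      simpa [iteratedFDeriv_two_apply] using hH v hv
    exact hlin κ' hκ' (h.mono fun q hq _ => hq)
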